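/- Let 0 < τ ≤ 1/64 and let c₁, c₂ > 0. There exist a constant C₀'₀ (depending on τ) and n₀ (depending on τ, C₀', c₁, c₂) such that for every C₀' ≥ C₀'₀, every n ≥ n₀, every t ∈ [−π,π] satisfying Condition(τ,C₀'), and every D ∈ ℝ² with c₁ n^{5τ−1/2} ≤ ‖D‖₂ ≤ c₂ n^{1−8τ}, one has ∑_{i=1}^{n} ( ‖⟨v_i, D⟩‖_{ℝ/ℤ}² + ‖⟨v_i', D⟩‖_{ℝ/ℤ}² ) ≥ n^{τ}. -/

import Mathlib

open MeasureTheory Real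

/-- `t` satisfies Condition(τ, C₀'): there is no nonzero integer `k` with `|k| ≤ C₀'` such that
`‖kt/π‖_{ℝ/ℤ} ≤ n^{-1+8τ}`. -/
def Condition (n : ℕ) (τ C₀' t : ℝ) : Prop :=
  ∀ k : ℤ, k ≠ 0 → |(k : ℝ)| ≤ C₀' →
    ∀ m : ℤ, (n : ℝ) ^ (-1 + 8 * τ) < |(k : ℝ) * t / Real.pi - (m : ℝ)|

/-- The distance from `w` to the nearest integer, `‖w‖_{ℝ/ℤ}`. -/
noncomputable def distZ (w : ℝ) : ℝ := ⨅ m : ℤ, |w - (m : ℝ)|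

/-- `⟨v_i, x⟩` where `v_i = (cos(it), -(i/n) sin(it))`. -/
noncomputable def ipv (n : ℕ) (t : ℝ) (i : ℕ) (x : ℝ × ℝ) : ℝ :=
  Real.cos (i * t) * x.1 + (-((i : ℝ) / n) * Real.sin (i * t)) * x.2

/-- `⟨v_i', x⟩` where `v_i' = (sin(it), (i/n) cos(it))`. -/
noncomputable def ipv' (n : ℕ) (t : ℝ) (i : ℕ) (x : ℝ × ℝ) : ℝ :=
  Real.sin (i * t) * x.1 + ((i : ℝ) / n) * Real.cos (i * t) * x.2

/-- Every `m` with `φ m ≤ d` divides `((d + 1)!) ^ (d + 1)`. -/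
theorem dvd_factorial_pow_of_totient_le {d m : ℕ} (hm : 0 < m) (h : m.totient ≤ d) :
    m ∣ (d + 1).factorial ^ (d + 1) := by
  rw [Nat.dvd_iff_prime_pow_dvd_dvd]
  intro p a hp ha
  rcases Nat.eq_zero_or_pos a with rfl | ha0
  · simp
  have hle : p ^ (a - 1) * (p - 1) ≤ d := by
    rw [← Nat.totient_prime_pow hp ha0]
    exact (Nat.le_of_dvd (Nat.totient_pos.2 hm) (Nat.totient_dvd_of_dvd ha)).trans h
  have hp1 : 1 ≤ p - 1 := by have := hp.two_le; omega
  have hpd : p ≤ d + 1 := by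
    have := Nat.le_mul_of_pos_left (p - 1) (pow_pos hp.pos (a - 1))
    omega
  have had : a ≤ d + 1 := by
    have h1 : a - 1 < p ^ (a - 1) := Nat.lt_pow_self hp.one_lt
    have h2 := Nat.le_mul_of_pos_right (p ^ (a - 1)) hp1
    omega
  exact (pow_dvd_pow p had).trans (pow_dvd_pow_of_dvd (Nat.dvd_factorial hp.pos hpd) _)

open Polynomial in
/-- A nonzero polynomial `P` of degree at most `d` and `(X ^ k - 1) ^ 2` generate an ideal of `ℚ[X]`
containing `(X ^ K - 1) ^ 2`, with control of the degrees of the coefficients, as soon as `K` is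
divisible by a number depending only on `d`. -/
theorem exists_eq_mul_add_mul_X_pow_sub_one_sq {d k K : ℕ} {P : ℚ[X]} (hP : P ≠ 0)
    (hd : P.natDegree ≤ d) (hk : 0 < k) (hK : 0 < K) (hdK : (d + 1).factorial ^ (d + 1) ∣ K) :
    ∃ A C : ℚ[X], (X ^ K - 1) ^ 2 = A * P + C * (X ^ k - 1) ^ 2 ∧
      A.natDegree ≤ 2 * k ∧ C.natDegree ≤ 2 * K + 2 * k + d := by
  classical
  set B : ℚ[X] := ∏ m ∈ k.divisors with ¬ m.totient ≤ d, cyclotomic m ℚ with hB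
  set G : ℚ[X] := ∏ m ∈ k.divisors with m.totient ≤ d, cyclotomic m ℚ with hG
  have hGB : X ^ k - 1 = G * B := by
    rw [← prod_cyclotomic_eq_X_pow_sub_one hk ℚ, hG, hB, Finset.prod_filter_mul_prod_filter_not]
  obtain ⟨T, hT⟩ : G ∣ X ^ K - 1 := by
    rw [← prod_cyclotomic_eq_X_pow_sub_one hK ℚ]
    refine Finset.prod_dvd_prod_of_subset _ _ _ fun m hm => ?_
    simp only [Finset.mem_filter, Nat.mem_divisors] at hm ⊢
    exact ⟨(dvd_factorial_pow_of_totient_le (Nat.pos_of_dvd_of_pos hm.1.1 hk) hm.2).trans hdK,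
      hK.ne'⟩
  have hcop : IsCoprime P (B ^ 2) := by
    refine IsCoprime.pow_right (IsCoprime.prod_right fun m hm => ?_)
    simp only [Finset.mem_filter, Nat.mem_divisors] at hm
    refine IsCoprime.symm ((Irreducible.coprime_iff_not_dvd (cyclotomic.irreducible_rat
      (Nat.pos_of_dvd_of_pos hm.1.1 hk))).2 fun hdvd => hm.2 ?_)
    rw [← natDegree_cyclotomic m ℚ]
    exact (natDegree_le_of_dvd hdvd hP).trans hd
  obtain ⟨u, v, huv⟩ := hcop
  have hmon0 : (X ^ k - 1 : ℚ[X]).Monic := monic_X_pow_sub_C 1 hk.ne'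
  have hmon : ((X ^ k - 1 : ℚ[X]) ^ 2).Monic := hmon0.pow 2
  have hQdeg : ((X ^ k - 1 : ℚ[X]) ^ 2).natDegree = 2 * k := by
    rw [natDegree_pow, ← C_1, natDegree_X_pow_sub_C]
  have hFdeg : ((X ^ K - 1 : ℚ[X]) ^ 2).natDegree = 2 * K := by
    rw [natDegree_pow, ← C_1, natDegree_X_pow_sub_C]
  set Q : ℚ[X] := (X ^ k - 1) ^ 2 with hQ
  set W := T ^ 2 * u * G ^ 2
  have hdiv := modByMonic_add_div W Q
  have hAdeg : (W %ₘ Q).natDegree ≤ 2 * k := by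
    rw [← hQdeg]; exact natDegree_modByMonic_le _ hmon
  have heq : (X ^ K - 1 : ℚ[X]) ^ 2 = (W %ₘ Q) * P + (T ^ 2 * v + (W /ₘ Q) * P) * Q := by
    have h1 : Q = G ^ 2 * B ^ 2 := by rw [hQ, hGB]; ring
    have h2 : (X ^ K - 1 : ℚ[X]) ^ 2 = W * P + T ^ 2 * v * Q := by
      rw [hT, h1]
      linear_combination -(G * T) ^ 2 * huv
    rw [h2]
    linear_combination -P * hdiv
  refine ⟨_, _, heq, hAdeg, ?_⟩
  set Z := T ^ 2 * v + (W /ₘ Q) * P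
  by_cases hZ : Z = 0
  · simp [hZ]
  have h3 : (Z * Q).natDegree = Z.natDegree + 2 * k := by
    rw [natDegree_mul hZ hmon.ne_zero, hQdeg]
  have h4 : Z * Q = (X ^ K - 1 : ℚ[X]) ^ 2 - (W %ₘ Q) * P := by rw [heq]; ring
  have h5 : (Z * Q).natDegree ≤ max (2 * K) (2 * k + d) := by
    rw [h4]
    refine (natDegree_sub_le _ _).trans (max_le_max hFdeg.le ?_)
    exact natDegree_mul_le.trans (add_le_add hAdeg hd)
  have := max_le_add_of_nonneg (Nat.zero_le (2 * K)) (Nat.zero_le (2 * k + d))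
  omega

/-- The value at `x` of the sequence `p(E) g`, where `E` is the forward shift. -/
noncomputable def shiftEval (g : ℕ → ℂ) (x : ℕ) : Polynomial ℂ →ₗ[ℂ] ℂ :=
  Polynomial.lsum fun i => LinearMap.toSpanSingleton ℂ ℂ (g (x + i))

section shiftEval

open Polynomial

theorem shiftEval_monomial (g : ℕ → ℂ) (x i : ℕ) (c : ℂ) :
    shiftEval g x (monomial i c) = c * g (x + i) := by
  simp [shiftEval, Polynomial.lsum_apply]

theorem shiftEval_eq_sum (g : ℕ → ℂ) (x : ℕ) (p : ℂ[X]) :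
    shiftEval g x p = ∑ i ∈ Finset.range (p.natDegree + 1), p.coeff i * g (x + i) := by
  conv_lhs => rw [p.as_sum_range, map_sum]
  simp_rw [shiftEval_monomial]

theorem shiftEval_X_pow_mul (g : ℕ → ℂ) (x i : ℕ) (p : ℂ[X]) :
    shiftEval g x (X ^ i * p) = shiftEval g (x + i) p := by
  induction p using Polynomial.induction_on' with
  | add p q hp hq => rw [mul_add, map_add, map_add, hp, hq]
  | monomial j c =>
    rw [X_pow_mul_monomial, shiftEval_monomial, shiftEval_monomial, add_assoc, add_comm i j]

theorem shiftEval_mul_eq_zero {g : ℕ → ℂ} {x J : ℕ} {C Q : ℂ[X]}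
    (h : ∀ j ≤ J, shiftEval g (x + j) Q = 0) (hC : C.natDegree ≤ J) :
    shiftEval g x (C * Q) = 0 := by
  rw [C.as_sum_range, Finset.sum_mul, map_sum]
  refine Finset.sum_eq_zero fun i hi => ?_
  rw [← C_mul_X_pow_eq_monomial, mul_assoc, ← smul_eq_C_mul, map_smul, shiftEval_X_pow_mul,
    h i (by simp at hi; omega), smul_zero]

theorem shiftEval_X_pow_sub_one_sq (g : ℕ → ℂ) (x k : ℕ) :
    shiftEval g x ((X ^ k - 1) ^ 2) = g (x + 2 * k) - 2 * g (x + k) + g x := by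
  have : ((X ^ k - 1) ^ 2 : ℂ[X]) = monomial (2 * k) 1 - monomial k 2 + monomial 0 1 := by
    simp only [← C_mul_X_pow_eq_monomial]
    simp only [map_one, C_ofNat]
    ring
  rw [this, map_add, map_sub]
  simp only [shiftEval_monomial]
  simp

theorem shiftEval_sub (f g : ℕ → ℂ) (x : ℕ) (p : ℂ[X]) :
    shiftEval (fun i => f i - g i) x p = shiftEval f x p - shiftEval g x p := by
  simp [shiftEval_eq_sum, mul_sub]

/-- The action on the sequence `z ^ x * (a + b * x)`. -/
theorem shiftEval_pow_mul_affine (z a b : ℂ) (x : ℕ) (p : ℂ[X]) :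
    shiftEval (fun i => z ^ i * (a + b * i)) x p =
      z ^ x * ((a + b * x) * p.eval z + b * z * (derivative p).eval z) := by
  induction p using Polynomial.induction_on' with
  | add p q hp hq => rw [map_add, hp, hq]; simp; ring
  | monomial j c =>
    rw [shiftEval_monomial]
    rcases j with _ | j
    · simp; ring
    · simp [pow_add]; ring

theorem norm_shiftEval_le {g : ℕ → ℂ} {x d : ℕ} {p : ℂ[X]} {ε H : ℝ} (hH : 0 ≤ H)
    (hg : ∀ i ≤ d, ‖g (x + i)‖ ≤ ε) (hp : p.natDegree ≤ d) (hc : ∀ i, ‖p.coeff i‖ ≤ H) :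
    ‖shiftEval g x p‖ ≤ (d + 1) * H * ε := by
  have hs : shiftEval g x p = ∑ i ∈ Finset.range (d + 1), p.coeff i * g (x + i) := by
    conv_lhs => rw [p.as_sum_range' (d + 1) (by omega), map_sum]
    simp_rw [shiftEval_monomial]
  rw [hs]
  refine (norm_sum_le_of_le _ fun i hi => ?_).trans_eq
    (b := ∑ i ∈ Finset.range (d + 1), H * ε) (by simp; ring)
  rw [norm_mul]
  exact mul_le_mul (hc i) (hg i (by simp at hi; omega)) (norm_nonneg _) hH

end shiftEval

theorem eq_zero_of_mem_range_toComplex_of_norm_lt_one {z : ℂ}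
    (hz : z ∈ GaussianInt.toComplex.range) (h : ‖z‖ < 1) : z = 0 := by
  obtain ⟨g, rfl⟩ := hz
  have h1 : Complex.normSq (GaussianInt.toComplex g) < 1 := by
    rw [Complex.normSq_eq_norm_sq]
    nlinarith [norm_nonneg (GaussianInt.toComplex g)]
  rw [← GaussianInt.intCast_real_norm] at h1
  have h2 : g.norm < 1 := by exact_mod_cast h1
  have h3 : g.norm = 0 := le_antisymm (by omega) (GaussianInt.norm_nonneg g)
  rw [GaussianInt.norm_eq_zero.1 h3, map_zero]

theorem shiftEval_map_int_mem_range {g : ℕ → ℂ} (hg : ∀ i, g i ∈ GaussianInt.toComplex.range)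
    (x : ℕ) (p : Polynomial ℤ) :
    shiftEval g x (p.map (Int.castRingHom ℂ)) ∈ GaussianInt.toComplex.range := by
  rw [shiftEval_eq_sum]
  refine sum_mem fun i _ => mul_mem ?_ (hg _)
  rw [Polynomial.coeff_map]
  exact intCast_mem _ _

open Polynomial in
/-- Pigeonhole construction of a short integer polynomial which is small, together with its
derivative, at a given point of the unit circle. -/
theorem exists_int_polynomial_small {z : ℂ} (hz : ‖z‖ = 1) {d H M : ℕ} {R : ℝ} (hR : 0 < R)
    (hM : R * ((d + 1) ^ 2 * H) ≤ M) (hcard : (2 * M + 1) ^ 4 < (H + 1) ^ (d + 1)) :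
    ∃ P : ℤ[X], P ≠ 0 ∧ P.natDegree ≤ d ∧ (∀ i, |P.coeff i| ≤ H) ∧
      ‖(P.map (Int.castRingHom ℂ)).eval z‖ ≤ 2 / R ∧
      ‖(derivative (P.map (Int.castRingHom ℂ))).eval z‖ ≤ 2 / R := by
  classical
  let p : (Fin (d + 1) → Fin (H + 1)) → ℤ[X] := fun c => ofFn (d + 1) fun i => ((c i : ℕ) : ℤ)
  let q : (Fin (d + 1) → Fin (H + 1)) → ℂ[X] := fun c => (p c).map (Int.castRingHom ℂ)
  have hq : ∀ c, q c = ∑ i : Fin (d + 1), monomial (i : ℕ) ((c i : ℕ) : ℂ) := fun c => by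
    simp [q, p, ofFn_eq_sum_monomial, Polynomial.map_sum]
  have h0 : ∀ c, ‖(q c).eval z‖ ≤ (d + 1) ^ 2 * H := fun c => by
    rw [hq, eval_finsetSum]
    refine (norm_sum_le _ _).trans ((Finset.sum_le_card_nsmul _ _ ((d + 1 : ℝ) * H)
      fun i _ => ?_).trans_eq (by simp; ring))
    have : ((c i : ℕ) : ℝ) ≤ H := by exact_mod_cast Nat.lt_succ_iff.1 (c i).2
    have hH : (0 : ℝ) ≤ H := Nat.cast_nonneg _
    have hd : (0 : ℝ) ≤ d := Nat.cast_nonneg _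
    simp [hz]
    nlinarith
  have h1 : ∀ c, ‖(derivative (q c)).eval z‖ ≤ (d + 1) ^ 2 * H := fun c => by
    rw [hq, derivative_sum, eval_finsetSum]
    refine (norm_sum_le _ _).trans ((Finset.sum_le_card_nsmul _ _ ((d + 1 : ℝ) * H)
      fun i _ => ?_).trans_eq (by simp; ring))
    have : ((c i : ℕ) : ℝ) ≤ H := by exact_mod_cast Nat.lt_succ_iff.1 (c i).2
    have hi : ((i : ℕ) : ℝ) ≤ d + 1 := by exact_mod_cast i.2.le
    simp [hz, derivative_monomial]
    rw [mul_comm]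
    gcongr
  let F : (Fin (d + 1) → Fin (H + 1)) → ℤ × ℤ × ℤ × ℤ := fun c =>
    (⌊R * ((q c).eval z).re⌋, ⌊R * ((q c).eval z).im⌋,
      ⌊R * ((derivative (q c)).eval z).re⌋, ⌊R * ((derivative (q c)).eval z).im⌋)
  have hfl : ∀ y : ℝ, |y| ≤ (d + 1) ^ 2 * H → ⌊R * y⌋ ∈ Finset.Icc (-(M : ℤ)) M := fun y hy => by
    have h2 : |R * y| ≤ M := by
      rw [abs_mul, abs_of_pos hR]; exact (mul_le_mul_of_nonneg_left hy hR.le).trans hM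
    rw [Finset.mem_Icc]
    refine ⟨Int.le_floor.2 ?_, Int.floor_le_iff.2 ?_⟩
    · push_cast; exact (abs_le.1 h2).1
    · have := (abs_le.1 h2).2
      push_cast; linarith
  let S := Finset.Icc (-(M : ℤ)) M
  have hF : ∀ c ∈ Finset.univ, F c ∈ S ×ˢ S ×ˢ S ×ˢ S := fun c _ => by
    simp only [Finset.mem_product]
    exact ⟨hfl _ ((Complex.abs_re_le_norm _).trans (h0 c)),
      hfl _ ((Complex.abs_im_le_norm _).trans (h0 c)),
      hfl _ ((Complex.abs_re_le_norm _).trans (h1 c)),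
      hfl _ ((Complex.abs_im_le_norm _).trans (h1 c))⟩
  have hS : S.card = 2 * M + 1 := by simp [S]; omega
  obtain ⟨c, -, c', -, hcc, hFc⟩ := Finset.exists_ne_map_eq_of_card_lt_of_maps_to
    (s := Finset.univ) (t := S ×ˢ S ×ˢ S ×ˢ S) (f := F) (by
      simp only [Finset.card_product, hS, Finset.card_univ, Fintype.card_fun, Fintype.card_fin]
      calc _ = (2 * M + 1) ^ 4 := by ring
        _ < _ := hcard) hF
  have hsmall : ∀ u v : ℂ, ⌊R * u.re⌋ = ⌊R * v.re⌋ → ⌊R * u.im⌋ = ⌊R * v.im⌋ →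
      ‖u - v‖ ≤ 2 / R := fun u v hre him => by
    refine (Complex.norm_le_abs_re_add_abs_im _).trans ?_
    have h2 := Int.abs_sub_lt_one_of_floor_eq_floor hre
    have h3 := Int.abs_sub_lt_one_of_floor_eq_floor him
    rw [← mul_sub, abs_mul, abs_of_pos hR] at h2 h3
    rw [le_div_iff₀ hR, Complex.sub_re, Complex.sub_im]
    linarith
  simp only [F, Prod.mk.injEq] at hFc
  have hmap : (p c - p c').map (Int.castRingHom ℂ) = q c - q c' := Polynomial.map_sub _
  refine ⟨p c - p c', fun h => hcc ?_, ?_, fun i => ?_, ?_, ?_⟩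
  · have h2 := injective_ofFn (d + 1) (sub_eq_zero.1 h)
    funext i
    have := congrFun h2 i
    exact Fin.ext (by exact_mod_cast this)
  · refine (natDegree_sub_le _ _).trans (max_le ?_ ?_) <;>
      exact Nat.lt_succ_iff.1 (ofFn_natDegree_lt (by omega) _)
  · rw [coeff_sub]
    by_cases hi : i < d + 1
    · simp only [p, ofFn_coeff_eq_val_of_lt _ hi]
      have := (c ⟨i, hi⟩).2
      have := (c' ⟨i, hi⟩).2
      rw [abs_le]; omega
    · simp only [p, ofFn_coeff_eq_zero_of_ge _ (not_lt.1 hi)]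
      simp
  · rw [hmap, eval_sub]
    exact hsmall _ _ hFc.1 hFc.2.1
  · rw [hmap, derivative_sub, eval_sub]
    exact hsmall _ _ hFc.2.2.1 hFc.2.2.2

open Polynomial in
/-- If `x ↦ z ^ x * (α + β * x)` is approximated by Gaussian integers on a long window and is almost
annihilated there by a short integer polynomial and by `(E ^ k - 1) ^ 2`, then it is almost
annihilated by `(E ^ K - 1) ^ 2`. -/
theorem norm_pow_sub_one_sq_le {z α β : ℂ} (hz : ‖z‖ = 1) {w : ℕ → ℂ}
    (hw : ∀ i, w i ∈ GaussianInt.toComplex.range) {x₀ L k K d H : ℕ} {ε : ℝ}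
    (herr : ∀ i ≤ L, ‖z ^ (x₀ + i) * (α + β * (x₀ + i : ℕ)) - w (x₀ + i)‖ ≤ ε)
    {P : ℤ[X]} (hP : P ≠ 0) (hPd : P.natDegree ≤ d) (hPH : ∀ i, |P.coeff i| ≤ H)
    (hPz : ∀ i ≤ L, ‖(α + β * (x₀ + i : ℕ)) * (P.map (Int.castRingHom ℂ)).eval z +
      β * z * (derivative (P.map (Int.castRingHom ℂ))).eval z‖ + (d + 1) * H * ε < 1)
    (hkz : ∀ i ≤ L, ‖(α + β * (x₀ + i : ℕ)) * (z ^ k - 1) ^ 2 +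
      2 * β * k * z ^ k * (z ^ k - 1)‖ + 4 * ε < 1)
    (hk : 0 < k) (hK : 0 < K) (hdK : (d + 1).factorial ^ (d + 1) ∣ K)
    (hL : 2 * K + 4 * k + 2 * d ≤ L) :
    ‖(α + β * x₀) * (z ^ K - 1) ^ 2 + 2 * β * K * z ^ K * (z ^ K - 1)‖ ≤ 4 * ε := by
  set f : ℕ → ℂ := fun i => z ^ i * (α + β * i) with hf
  set e : ℕ → ℂ := fun i => f i - w i with he
  have hzx : ∀ x : ℕ, ‖z ^ x‖ = 1 := fun x => by rw [norm_pow, hz, one_pow]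
  have hsub : ∀ (x : ℕ) (p : ℂ[X]), shiftEval e x p = shiftEval f x p - shiftEval w x p :=
    fun x p => shiftEval_sub f w x p
  have hfX : ∀ x m : ℕ, ‖shiftEval f x ((X ^ m - 1) ^ 2)‖ =
      ‖(α + β * x) * (z ^ m - 1) ^ 2 + 2 * β * m * z ^ m * (z ^ m - 1)‖ := fun x m => by
    rw [shiftEval_X_pow_sub_one_sq, ← one_mul ‖(α + β * x) * _ + _‖, ← hzx x, ← norm_mul]
    congr 1
    simp only [hf]
    push_cast
    ring
  have heX : ∀ x m : ℕ, x + 2 * m ≤ L → ‖shiftEval e (x₀ + x) ((X ^ m - 1) ^ 2)‖ ≤ 4 * ε :=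
    fun x m hx => by
    rw [shiftEval_X_pow_sub_one_sq, add_assoc, add_assoc]
    have h0 : ‖e (x₀ + x)‖ ≤ ε := herr x (by omega)
    have h1 : ‖e (x₀ + (x + m))‖ ≤ ε := herr (x + m) (by omega)
    have h2 : ‖e (x₀ + (x + 2 * m))‖ ≤ ε := herr (x + 2 * m) hx
    have h3 := norm_add_le (e (x₀ + (x + 2 * m)) - 2 * e (x₀ + (x + m))) (e (x₀ + x))
    have h4 := norm_sub_le (e (x₀ + (x + 2 * m))) (2 * e (x₀ + (x + m)))
    rw [norm_mul, Complex.norm_ofNat] at h4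
    linarith
  have hwP : ∀ j ≤ 2 * k, shiftEval w (x₀ + j) (P.map (Int.castRingHom ℂ)) = 0 := fun j hj => by
    refine eq_zero_of_mem_range_toComplex_of_norm_lt_one (shiftEval_map_int_mem_range hw _ _) ?_
    have h1 : ‖shiftEval f (x₀ + j) (P.map (Int.castRingHom ℂ))‖ + (d + 1) * H * ε < 1 := by
      rw [hf, shiftEval_pow_mul_affine, norm_mul, hzx, one_mul]
      exact hPz j (by omega)
    have h2 : ‖shiftEval e (x₀ + j) (P.map (Int.castRingHom ℂ))‖ ≤ (d + 1) * H * ε := by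
      refine norm_shiftEval_le (Nat.cast_nonneg _) (fun i hi => ?_)
        (natDegree_map_le.trans hPd) fun i => ?_
      · rw [add_assoc]; exact herr (j + i) (by omega)
      · rw [coeff_map, eq_intCast, Complex.norm_intCast]
        exact_mod_cast hPH i
    have h3 : shiftEval w (x₀ + j) (P.map (Int.castRingHom ℂ)) =
      shiftEval f (x₀ + j) (P.map (Int.castRingHom ℂ)) -
        shiftEval e (x₀ + j) (P.map (Int.castRingHom ℂ)) := by rw [hsub]; ring
    rw [h3]
    linarith [norm_sub_le (shiftEval f (x₀ + j) (P.map (Int.castRingHom ℂ)))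
      (shiftEval e (x₀ + j) (P.map (Int.castRingHom ℂ)))]
  have hwQ : ∀ j ≤ 2 * K + 2 * k + d, shiftEval w (x₀ + j) ((X ^ k - 1) ^ 2) = 0 :=
    fun j hj => by
    have hmap : ((X ^ k - 1) ^ 2 : ℂ[X]) = ((X ^ k - 1) ^ 2 : ℤ[X]).map (Int.castRingHom ℂ) := by
      simp
    refine eq_zero_of_mem_range_toComplex_of_norm_lt_one
      (hmap ▸ shiftEval_map_int_mem_range hw _ _) ?_
    have h1 : shiftEval w (x₀ + j) ((X ^ k - 1) ^ 2) =
      shiftEval f (x₀ + j) ((X ^ k - 1) ^ 2) - shiftEval e (x₀ + j) ((X ^ k - 1) ^ 2) := by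
      rw [hsub]; ring
    rw [h1]
    have h2 := heX j k (by omega)
    have h3 := hkz j (by omega)
    rw [← hfX] at h3
    linarith [norm_sub_le (shiftEval f (x₀ + j) ((X ^ k - 1) ^ 2))
      (shiftEval e (x₀ + j) ((X ^ k - 1) ^ 2))]
  obtain ⟨A, C, hAC, hA, hC⟩ := exists_eq_mul_add_mul_X_pow_sub_one_sq
    (P := P.map (Int.castRingHom ℚ))
    ((Polynomial.map_ne_zero_iff (Int.castRingHom ℚ).injective_int).2 hP)
    (natDegree_map_le.trans hPd) hk hK hdK
  have hwK : shiftEval w x₀ ((X ^ K - 1) ^ 2) = 0 := by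
    have h1 := congrArg (Polynomial.map (algebraMap ℚ ℂ)) hAC
    simp only [Polynomial.map_pow, Polynomial.map_sub, Polynomial.map_add, Polynomial.map_mul,
      Polynomial.map_one, map_X, Polynomial.map_map] at h1
    have h2 : (algebraMap ℚ ℂ).comp (Int.castRingHom ℚ) = Int.castRingHom ℂ :=
      RingHom.ext_int _ _
    rw [h1, h2, map_add, shiftEval_mul_eq_zero hwP (natDegree_map_le.trans hA),
      shiftEval_mul_eq_zero hwQ (natDegree_map_le.trans hC), add_zero]
  rw [← hfX]
  have h1 := heX 0 K (by omega)
  rwa [add_zero, hsub, hwK, sub_zero] at h1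

/-- A nonnegative sequence with small sum is uniformly small on a long window in the second half
of its range. -/
theorem exists_window_le {g : ℕ → ℝ} (hg : ∀ i, 0 ≤ g i) {n L q : ℕ} (hn : 0 < n)
    (hq : 2 * (q * (L + 1)) ≤ n) {ε : ℝ} (hS : ∑ i ∈ Finset.Icc 1 n, g i < q * ε) :
    ∃ x₀, n ≤ 2 * x₀ ∧ x₀ + L ≤ n ∧ ∀ i ≤ L, g (x₀ + i) ≤ ε := by
  by_contra! hcon
  have hb : ∀ j < q, (n - n / 2) + j * (L + 1) + L < n + 1 := fun j hj => by
    have : (j + 1) * (L + 1) ≤ q * (L + 1) := Nat.mul_le_mul_right _ hj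
    rw [add_mul] at this
    omega
  have hex : ∀ j, ∃ i ≤ L, j < q → ε < g ((n - n / 2) + j * (L + 1) + i) := fun j => by
    by_cases hj : j < q
    · obtain ⟨i, hi, h⟩ := hcon ((n - n / 2) + j * (L + 1)) (by omega)
        (Nat.lt_succ_iff.1 (hb j hj))
      exact ⟨i, hi, fun _ => h⟩
    · exact ⟨0, Nat.zero_le _, fun h => absurd h hj⟩
  choose e heL he using hex
  have hinj : Set.InjOn (fun j => (n - n / 2) + j * (L + 1) + e j) (Finset.range q) := by
    intro j _ j' _ h
    simp only at h
    have h1 : j * (L + 1) + e j = j' * (L + 1) + e j' := by omega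
    have h2 : ∀ j, (j * (L + 1) + e j) / (L + 1) = j := fun j => by
      rw [mul_comm, Nat.mul_add_div (Nat.succ_pos L),
        Nat.div_eq_of_lt (Nat.lt_succ_of_le (heL j)), add_zero]
    rw [← h2 j, h1, h2]
  refine absurd hS (not_lt.2 ?_)
  calc (q : ℝ) * ε = ∑ _j ∈ Finset.range q, ε := by simp
    _ ≤ ∑ j ∈ Finset.range q, g ((n - n / 2) + j * (L + 1) + e j) :=
        Finset.sum_le_sum fun j hj => (he j (Finset.mem_range.1 hj)).le
    _ = ∑ i ∈ (Finset.range q).image fun j => (n - n / 2) + j * (L + 1) + e j, g i :=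
        (Finset.sum_image hinj).symm
    _ ≤ ∑ i ∈ Finset.Icc 1 n, g i := by
        refine Finset.sum_le_sum_of_subset_of_nonneg ?_ fun i _ _ => hg i
        intro i hi
        obtain ⟨j, hj, rfl⟩ := Finset.mem_image.1 hi
        have := hb j (Finset.mem_range.1 hj)
        have := heL j
        rw [Finset.mem_Icc]
        omega

theorem exists_norm_exp_pow_sub_one_le (t : ℝ) {n : ℕ} (hn : 0 < n) :
    ∃ k : ℕ, 0 < k ∧ k ^ 2 ≤ n ∧ ‖Complex.exp (Complex.I * t) ^ k - 1‖ ≤ 2 * π / √n := by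
  obtain ⟨k, hk0, hk, h⟩ := Real.exists_nat_abs_mul_sub_round_le (t / (2 * π)) (Nat.sqrt_pos.2 hn)
  refine ⟨k, hk0, (Nat.pow_le_pow_left hk 2).trans (Nat.sqrt_le' n), ?_⟩
  set m := round ((k : ℝ) * (t / (2 * π)))
  have h1 : Complex.exp (Complex.I * t) ^ k =
      Complex.exp (Complex.I * ((2 * π * (k * (t / (2 * π)) - m) : ℝ) : ℂ)) := by
    rw [← Complex.exp_nat_mul, Complex.exp_eq_exp_iff_exists_int]
    refine ⟨m, ?_⟩
    push_cast
    have : (π : ℂ) ≠ 0 := by exact_mod_cast Real.pi_ne_zero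
    field_simp
    ring
  rw [h1]
  refine Real.norm_exp_I_mul_ofReal_sub_one_le.trans ?_
  rw [Real.norm_eq_abs, abs_mul, abs_of_pos Real.two_pi_pos, div_eq_mul_one_div (2 * π) (√n)]
  refine mul_le_mul_of_nonneg_left (h.trans ?_) Real.two_pi_pos.le
  refine one_div_le_one_div_of_le (Real.sqrt_pos.2 (by exact_mod_cast hn)) ?_
  refine Real.sqrt_le_iff.2 ⟨by positivity, ?_⟩
  exact_mod_cast (Nat.lt_succ_sqrt' n).le

theorem exists_one_le_norm_exp_pow_sub_one {t δ : ℝ} {N : ℕ} (hδ : 0 < δ)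
    (h : ∀ m : ℤ, δ < |N * t / π - m|) :
    ∃ M : ℕ, 0 < M ∧ (M : ℝ) ≤ 1 / (4 * δ) + 1 ∧
      1 ≤ ‖Complex.exp (Complex.I * t) ^ (2 * N * M) - 1‖ := by
  set m := round (N * t / π)
  set s := N * t / π - m with hs
  have hsδ : δ < |s| := h m
  have hs2 : |s| ≤ 1 / 2 := abs_sub_round _
  have hs0 : 0 < |s| := hδ.trans hsδ
  set M := ⌈1 / (4 * |s|)⌉₊ with hM
  have hM1 : 1 / (4 * |s|) ≤ M := Nat.le_ceil _
  have hM2 : (M : ℝ) < 1 / (4 * |s|) + 1 := Nat.ceil_lt_add_one (by positivity)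
  refine ⟨M, Nat.ceil_pos.2 (by positivity), hM2.le.trans ?_, ?_⟩
  · gcongr
  have h1 : Complex.exp (Complex.I * t) ^ (2 * N * M) =
      Complex.exp (Complex.I * ((2 * π * s * M : ℝ) : ℂ)) := by
    rw [← Complex.exp_nat_mul, Complex.exp_eq_exp_iff_exists_int]
    refine ⟨m * M, ?_⟩
    rw [hs]
    push_cast
    have : (π : ℂ) ≠ 0 := by exact_mod_cast Real.pi_ne_zero
    field_simp
    ring
  rw [h1, Complex.norm_exp_I_mul_ofReal_sub_one, Real.norm_eq_abs]
  have hcos : Real.cos (2 * π * s * M) ≤ 0 := by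
    have h2 : 1 / 4 ≤ |s| * M := by
      calc 1 / 4 = |s| * (1 / (4 * |s|)) := by field_simp
        _ ≤ _ := by gcongr
    have h3 : |s| * M ≤ 3 / 4 := by
      calc |s| * M ≤ |s| * (1 / (4 * |s|) + 1) := by gcongr
        _ = 1 / 4 + |s| := by field_simp
        _ ≤ _ := by linarith
    have h4 : |2 * π * s * M| = 2 * π * (|s| * M) := by
      rw [abs_mul, abs_mul, abs_of_pos Real.two_pi_pos, Nat.abs_cast, mul_assoc]
    rw [← Real.cos_abs, h4]
    have := Real.pi_pos
    exact Real.cos_nonpos_of_pi_div_two_le_of_le (by nlinarith) (by nlinarith)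
  have h5 : Real.cos (2 * π * s * M) = 1 - 2 * Real.sin (2 * π * s * M / 2) ^ 2 := by
    have := Real.cos_two_mul (2 * π * s * M / 2)
    have := Real.sin_sq_add_cos_sq (2 * π * s * M / 2)
    rw [mul_div_cancel₀ _ (two_ne_zero)] at *
    linarith
  refine (one_le_sq_iff₀ (abs_nonneg _)).1 ?_
  rw [sq_abs]
  nlinarith

theorem distZ_eq_abs_sub_round (w : ℝ) : distZ w = |w - round w| :=
  le_antisymm (ciInf_le ⟨0, by rintro _ ⟨m, rfl⟩; exact abs_nonneg _⟩ _)
    (le_ciInf fun m => round_le w m)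

theorem distZ_eq_abs {w : ℝ} (hw : |w| ≤ 1 / 2) : distZ w = |w| := by
  refine le_antisymm ?_ (le_ciInf fun m => ?_)
  · rw [distZ_eq_abs_sub_round]
    simpa using round_le w 0
  · rcases eq_or_ne m 0 with rfl | hm
    · simp
    · have h1 : (1 : ℝ) ≤ |(m : ℝ)| := by exact_mod_cast Int.one_le_abs hm
      have h2 := abs_sub_abs_le_abs_sub (m : ℝ) w
      rw [abs_sub_comm] at h2
      linarith

theorem ipv_sq_add_ipv'_sq (n : ℕ) (t : ℝ) (i : ℕ) (D : ℝ × ℝ) :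
    ipv n t i D ^ 2 + ipv' n t i D ^ 2 = D.1 ^ 2 + ((i : ℝ) / n) ^ 2 * D.2 ^ 2 := by
  unfold ipv ipv'
  linear_combination (D.1 ^ 2 + ((i : ℝ) / n) ^ 2 * D.2 ^ 2) * Real.sin_sq_add_cos_sq (i * t)

theorem ipv_add_ipv'_mul_I (n : ℕ) (t : ℝ) (i : ℕ) (D : ℝ × ℝ) :
    (ipv n t i D : ℂ) + ipv' n t i D * Complex.I =
      Complex.exp (Complex.I * t) ^ i * (D.1 + (D.2 / n : ℝ) * Complex.I * i) := by
  have h : Complex.exp (Complex.I * t) ^ i =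
      Real.cos (i * t) + Real.sin (i * t) * Complex.I := by
    rw [← Complex.exp_nat_mul, Complex.ofReal_cos, Complex.ofReal_sin, ← Complex.exp_mul_I]
    congr 1
    push_cast
    ring
  rw [h]
  unfold ipv ipv'
  push_cast
  linear_combination -(Complex.sin (i * t) * (D.2 / n) * i) * Complex.I_sq

/-- When `D` is short there is no wrap-around and the sum is computed directly. -/
theorem mul_le_sum_distZ_sq {n : ℕ} (hn : 0 < n) (t : ℝ) {D : ℝ × ℝ}
    (hD : D.1 ^ 2 + D.2 ^ 2 ≤ 1 / 4) :
    n / 8 * (D.1 ^ 2 + D.2 ^ 2) ≤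
      ∑ i ∈ Finset.Icc 1 n, (distZ (ipv n t i D) ^ 2 + distZ (ipv' n t i D) ^ 2) := by
  have hn' : (0 : ℝ) < n := by exact_mod_cast hn
  have hterm : ∀ i ∈ Finset.Icc 1 n, distZ (ipv n t i D) ^ 2 + distZ (ipv' n t i D) ^ 2 =
      D.1 ^ 2 + ((i : ℝ) / n) ^ 2 * D.2 ^ 2 := fun i hi => by
    rw [Finset.mem_Icc] at hi
    have h1 := ipv_sq_add_ipv'_sq n t i D
    have h2 : ((i : ℝ) / n) ^ 2 ≤ 1 :=
      pow_le_one₀ (by positivity) ((div_le_one hn').2 (by exact_mod_cast hi.2))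
    have h3 : ((i : ℝ) / n) ^ 2 * D.2 ^ 2 ≤ D.2 ^ 2 :=
      mul_le_of_le_one_left (sq_nonneg _) h2
    have h4 : |ipv n t i D| ≤ 1 / 2 := abs_le_of_sq_le_sq (by nlinarith) (by norm_num)
    have h5 : |ipv' n t i D| ≤ 1 / 2 := abs_le_of_sq_le_sq (by nlinarith) (by norm_num)
    rw [distZ_eq_abs h4, distZ_eq_abs h5, sq_abs, sq_abs, h1]
  rw [Finset.sum_congr rfl hterm]
  have hsub : Finset.Icc (n - n / 2) n ⊆ Finset.Icc 1 n :=
    Finset.Icc_subset_Icc_left (by omega)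
  refine le_trans ?_ (Finset.sum_le_sum_of_subset_of_nonneg hsub fun i _ _ => by positivity)
  have hcard : (n : ℝ) / 2 ≤ (Finset.Icc (n - n / 2) n).card := by
    rw [div_le_iff₀ two_pos, Nat.card_Icc]
    exact_mod_cast (by omega : n ≤ (n + 1 - (n - n / 2)) * 2)
  have hlow : ∀ i ∈ Finset.Icc (n - n / 2) n, (D.1 ^ 2 + D.2 ^ 2) / 4 ≤
      D.1 ^ 2 + ((i : ℝ) / n) ^ 2 * D.2 ^ 2 := fun i hi => by
    rw [Finset.mem_Icc] at hi
    have h1 : (1 : ℝ) / 2 ≤ i / n := by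
      rw [div_le_div_iff₀ two_pos hn']
      exact_mod_cast (by omega : 1 * n ≤ i * 2)
    have h2 : (1 : ℝ) / 4 ≤ ((i : ℝ) / n) ^ 2 := by nlinarith
    nlinarith [sq_nonneg D.1, sq_nonneg D.2]
  have h := Finset.card_nsmul_le_sum _ _ _ hlow
  rw [nsmul_eq_mul] at h
  nlinarith [sq_nonneg D.1, sq_nonneg D.2]

theorem le_norm_mul_pow_sub_one_sq_add {z A β : ℂ} {K : ℕ} (hz : ‖z‖ = 1)
    (hK : 1 ≤ ‖z ^ K - 1‖) (hβ : ‖β‖ * K ≤ ‖A‖ / 8) :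
    3 / 4 * ‖A‖ ≤ ‖A * (z ^ K - 1) ^ 2 + 2 * β * K * z ^ K * (z ^ K - 1)‖ := by
  have h1 : A * (z ^ K - 1) ^ 2 + 2 * β * K * z ^ K * (z ^ K - 1) =
      (z ^ K - 1) * (A * (z ^ K - 1) + 2 * β * K * z ^ K) := by ring
  have h2 := norm_sub_le_norm_add (A * (z ^ K - 1)) (2 * β * K * z ^ K)
  have h3 : ‖2 * β * K * z ^ K‖ = 2 * (‖β‖ * K) := by
    simp only [norm_mul, norm_pow, hz, one_pow, mul_one, Complex.norm_ofNat,
      Complex.norm_natCast, mul_assoc]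
  have h4 : ‖A‖ ≤ ‖A * (z ^ K - 1)‖ := by
    rw [norm_mul]
    exact le_mul_of_one_le_right (norm_nonneg _) hK
  rw [h1, norm_mul]
  exact le_trans (by linarith) (le_mul_of_one_le_left (norm_nonneg _) hK)

set_option maxHeartbeats 1000000 in
theorem pow_four_le_sum_distZ_sq {n d N : ℕ} {t Y c₁ c₂ : ℝ} (hN0 : 0 < N)
    (hdN : (d + 1).factorial ^ (d + 1) ∣ N) (hc₂ : 0 < c₂)
    (hY : 1000 ≤ Y) (hYd : 1000 * (d + 1 : ℝ) ^ 8 ≤ Y)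
    (hYN : 100 * (N : ℝ) ≤ Y) (hYc₂ : 100 * c₂ ≤ Y)
    (hYc₁ : 8 ≤ c₁ ^ 2 * Y) (hn : Y ^ 256 ≤ n) (hnd : (n : ℝ) ^ 5 ≤ Y ^ (4 * d))
    (ht : ∀ m : ℤ, Y ^ 32 / n < |N * t / π - m|) {D : ℝ × ℝ}
    (hD₁ : c₁ ^ 2 * Y ^ 40 / n ≤ D.1 ^ 2 + D.2 ^ 2)
    (hD₂ : D.1 ^ 2 + D.2 ^ 2 ≤ (c₂ * n / Y ^ 32) ^ 2) :
    Y ^ 4 ≤ ∑ i ∈ Finset.Icc 1 n,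
      (distZ (ipv n t i D) ^ 2 + distZ (ipv' n t i D) ^ 2) := by
  have hY0 : 0 < Y := by linarith
  have hY1 : 1 ≤ Y := by linarith
  have hn' : (0 : ℝ) < n := (pow_pos hY0 _).trans_le hn
  have hn0 : 0 < n := by exact_mod_cast hn'
  rcases le_or_gt (D.1 ^ 2 + D.2 ^ 2) (1 / 4) with hD | hD
  · refine le_trans ?_ (mul_le_sum_distZ_sq hn0 t hD)
    calc Y ^ 4 ≤ Y ^ 39 := pow_le_pow_right₀ hY1 (by norm_num)
      _ ≤ (c₁ ^ 2 * Y) / 8 * Y ^ 39 :=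
          le_mul_of_one_le_left (by positivity) ((one_le_div (by norm_num)).2 hYc₁)
      _ = n / 8 * (c₁ ^ 2 * Y ^ 40 / n) := by field_simp
      _ ≤ _ := by gcongr
  by_contra! hS
  set L := ⌊(n : ℝ) / Y ^ 16⌋₊
  set q := ⌊Y ^ 16 / 4⌋₊
  set H := ⌊Y ^ 4⌋₊
  set u := (n : ℝ) / Y ^ 16 with hu
  set ε := 1 / Y ^ 5 with hε
  set ρ := c₂ / Y ^ 32 with hρ
  have hρ0 : 0 ≤ ρ := by positivity
  have hρ1 : ρ ≤ 1 / 1000 := by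
    rw [hρ, div_le_iff₀ (by positivity)]
    have : Y * 1000 ≤ Y ^ 32 := by
      calc Y * 1000 ≤ Y * Y := by gcongr
        _ = Y ^ 2 := by ring
        _ ≤ Y ^ 32 := pow_le_pow_right₀ hY1 (by norm_num)
    linarith
  have hε1 : ε ≤ 1 / 1000 := by
    refine one_div_le_one_div_of_le (by norm_num) (hY.trans ?_)
    exact le_self_pow₀ hY1 (by norm_num)
  have huY : Y ^ 16 * 1000 ≤ u := by
    rw [hu, le_div_iff₀ (by positivity)]
    calc Y ^ 16 * 1000 * Y ^ 16 ≤ Y ^ 16 * Y * Y ^ 16 := by gcongr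
      _ = Y ^ 33 := by ring
      _ ≤ Y ^ 256 := pow_le_pow_right₀ hY1 (by norm_num)
      _ ≤ n := hn
  have hYY : 1000 ≤ Y ^ 16 := hY.trans (le_self_pow₀ hY1 (by norm_num))
  -- a window on which the sequence is close to Gaussian integers
  have hq : 2 * (q * (L + 1)) ≤ n := by
    have h1 : (q : ℝ) ≤ Y ^ 16 / 4 := Nat.floor_le (by positivity)
    have h2 : (L : ℝ) ≤ u := Nat.floor_le (by positivity)
    have h3 : (2 * (q * (L + 1)) : ℝ) ≤ n := by
      calc (2 * (q * (L + 1)) : ℝ) ≤ 2 * (Y ^ 16 / 4 * (2 * u)) := by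
            gcongr; linarith
        _ = n := by rw [hu]; field_simp; norm_num
    exact_mod_cast h3
  have hqS : Y ^ 4 ≤ q * ε ^ 2 := by
    have h1 : Y ^ 16 / 4 < q + 1 := Nat.lt_floor_add_one _
    have h2 : Y ^ 16 / 8 ≤ q := by linarith
    calc Y ^ 4 ≤ Y ^ 6 / 8 := by
          rw [le_div_iff₀ (by norm_num)]
          calc Y ^ 4 * 8 ≤ Y ^ 4 * (Y * 1) := by gcongr; linarith
            _ ≤ Y ^ 4 * (Y * Y) := by gcongr
            _ = Y ^ 6 := by ring
      _ = Y ^ 16 / 8 * ε ^ 2 := by rw [hε]; field_simp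
      _ ≤ _ := by gcongr
  obtain ⟨x₀, hx₀, hx₀L, hwin⟩ := exists_window_le (fun i => by positivity) hn0 hq
    (hS.trans_le hqS)
  set z := Complex.exp (Complex.I * t) with hzdef
  have hz : ‖z‖ = 1 := by rw [hzdef, mul_comm]; exact Complex.norm_exp_ofReal_mul_I t
  set α : ℂ := ((D.1 : ℝ) : ℂ) with hα
  set β : ℂ := (D.2 / n : ℝ) * Complex.I with hβ
  let w : ℕ → ℂ := fun i =>
    GaussianInt.toComplex ⟨round (ipv n t i D), round (ipv' n t i D)⟩
  have herr : ∀ i ≤ L, ‖z ^ (x₀ + i) * (α + β * (x₀ + i : ℕ)) - w (x₀ + i)‖ ≤ ε :=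
    fun i hi => by
    have h1 := hwin i hi
    rw [distZ_eq_abs_sub_round, distZ_eq_abs_sub_round, sq_abs, sq_abs] at h1
    rw [← ipv_add_ipv'_mul_I]
    refine (sq_le_sq₀ (norm_nonneg _) (by positivity)).1 (le_of_eq_of_le ?_ h1)
    rw [← Complex.normSq_eq_norm_sq, Complex.normSq_apply]
    simp [w, GaussianInt.toComplex_def₂]
    ring
  have hnorm : ∀ x : ℕ, ‖α + β * x‖ ^ 2 = D.1 ^ 2 + (D.2 * (x / n)) ^ 2 := fun x => by
    rw [← Complex.normSq_eq_norm_sq, Complex.normSq_apply]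
    simp [hα, hβ]
    ring
  have hβn : ‖β‖ = |D.2| / n := by simp [hβ]
  have hDρ : D.1 ^ 2 + D.2 ^ 2 ≤ (ρ * n) ^ 2 := by
    rwa [hρ, div_mul_eq_mul_div]
  have hβρ : ‖β‖ ≤ ρ := by
    rw [hβn, div_le_iff₀ hn']
    exact abs_le_of_sq_le_sq ((le_add_of_nonneg_left (sq_nonneg D.1)).trans hDρ) (by positivity)
  have hαρ : ∀ i ≤ L, ‖α + β * (x₀ + i : ℕ)‖ ≤ ρ * n := fun i hi => by
    refine (sq_le_sq₀ (norm_nonneg _) (by positivity)).1 (le_trans ?_ hDρ)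
    rw [hnorm, mul_pow]
    have h1 : (((x₀ + i : ℕ) : ℝ) / n) ^ 2 ≤ 1 :=
      pow_le_one₀ (by positivity) ((div_le_one hn').2 (by exact_mod_cast (by omega)))
    linarith [mul_le_of_le_one_right (sq_nonneg D.2) h1]
  -- the short polynomial
  have hH : (H : ℝ) ≤ Y ^ 4 := Nat.floor_le (by positivity)
  have hH' : Y ^ 4 < H + 1 := Nat.lt_floor_add_one _
  have hn1 : (1 : ℝ) ≤ n := by exact_mod_cast hn0
  obtain ⟨P, hP0, hPd, hPH, hPz, hPz'⟩ := exists_int_polynomial_small hz (d := d) (H := H)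
    (M := ⌈(n : ℝ) * ((d + 1) ^ 2 * H)⌉₊) hn' (Nat.le_ceil _) (by
      have h1 : (⌈(n : ℝ) * ((d + 1) ^ 2 * H)⌉₊ : ℝ) < n * ((d + 1) ^ 2 * H) + 1 :=
        Nat.ceil_lt_add_one (by positivity)
      have h2 : (n : ℝ) * ((d + 1) ^ 2 * H) ≤ n * ((d + 1) ^ 2 * Y ^ 4) := by gcongr
      have h3 : (1 : ℝ) ≤ n * ((d + 1) ^ 2 * Y ^ 4) := by
        have : (1 : ℝ) ≤ (d + 1) ^ 2 := one_le_pow₀ (by linarith [Nat.cast_nonneg (α := ℝ) d])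
        exact one_le_mul_of_one_le_of_one_le hn1
          (one_le_mul_of_one_le_of_one_le this (one_le_pow₀ hY1))
      have h4 : ((2 * ⌈(n : ℝ) * ((d + 1) ^ 2 * H)⌉₊ + 1 : ℝ)) ^ 4 < (H + 1 : ℝ) ^ (d + 1) := by
        calc ((2 * ⌈(n : ℝ) * ((d + 1) ^ 2 * H)⌉₊ + 1 : ℝ)) ^ 4
            ≤ (5 * (n * ((d + 1) ^ 2 * Y ^ 4))) ^ 4 := by gcongr; linarith
          _ = 625 * (d + 1) ^ 8 * (n ^ 4 * Y ^ 16) := by ring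
          _ ≤ Y * (n ^ 4 * Y ^ 16) := by gcongr; linarith
          _ = n ^ 4 * Y ^ 17 := by ring
          _ ≤ n ^ 4 * Y ^ 256 := by gcongr; norm_num
          _ ≤ n ^ 4 * n := by gcongr
          _ = n ^ 5 := by ring
          _ ≤ Y ^ (4 * d) := hnd
          _ ≤ Y ^ (4 * (d + 1)) := pow_le_pow_right₀ hY1 (by omega)
          _ = (Y ^ 4) ^ (d + 1) := pow_mul _ _ _
          _ < _ := pow_lt_pow_left₀ hH' (by positivity) (by omega)
      exact_mod_cast h4)
  obtain ⟨k, hk0, hkn, hkz⟩ := exists_norm_exp_pow_sub_one_le t hn0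
  obtain ⟨M, hM0, hM, hMz⟩ := exists_one_le_norm_exp_pow_sub_one (by positivity) ht
  rw [← hzdef] at hkz hMz
  have hsq : √(n : ℝ) ^ 2 = n := Real.sq_sqrt hn'.le
  have hs0 : 0 < √(n : ℝ) := Real.sqrt_pos.2 hn'
  have hks : (k : ℝ) ≤ √n := Real.le_sqrt_of_sq_le (by exact_mod_cast hkn)
  set K := 2 * N * M with hK
  have hK0 : 0 < K := by positivity
  have hKu : (K : ℝ) ≤ u / 100 := by
    have h1 : (M : ℝ) ≤ u / Y ^ 16 := by
      refine hM.trans ?_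
      have h2 : 1 / (4 * (Y ^ 32 / n)) = u / Y ^ 16 / 4 := by rw [hu]; field_simp
      have h3 : 1000 ≤ u / Y ^ 16 := by rw [le_div_iff₀ (by positivity)]; linarith
      rw [h2]; linarith
    calc (K : ℝ) = 2 * N * M := by rw [hK]; push_cast; ring
      _ ≤ 2 * (Y / 100) * (u / Y ^ 16) := by gcongr; linarith
      _ = u / 100 * (2 / Y ^ 15) := by field_simp
      _ ≤ u / 100 * 1 := by
        gcongr
        rw [div_le_one (by positivity)]
        have := le_self_pow₀ hY1 (by norm_num : (15 : ℕ) ≠ 0)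
        linarith
      _ = u / 100 := mul_one _
  have hL : 2 * K + 4 * k + 2 * d ≤ L := by
    refine Nat.le_floor ?_
    have h1 : (d : ℝ) ≤ u / 100 := by
      have h2 : (d : ℝ) + 1 ≤ (d + 1) ^ 8 :=
        le_self_pow₀ (by linarith [Nat.cast_nonneg (α := ℝ) d]) (by norm_num)
      have := le_self_pow₀ hY1 (by norm_num : (16 : ℕ) ≠ 0)
      linarith
    have h2 : (k : ℝ) ≤ u / 100 := by
      have h3 : 100 * Y ^ 16 ≤ √n := by
        refine Real.le_sqrt_of_sq_le (le_trans ?_ hn)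
        calc (100 * Y ^ 16) ^ 2 = 100 * 100 * Y ^ 32 := by ring
          _ ≤ Y * Y * Y ^ 32 := by gcongr <;> linarith
          _ = Y ^ 34 := by ring
          _ ≤ Y ^ 256 := pow_le_pow_right₀ hY1 (by norm_num)
      have h4 : √(n : ℝ) ≤ u / 100 := by
        rw [hu, div_div, le_div_iff₀ (by positivity)]
        calc √(n : ℝ) * (Y ^ 16 * 100) ≤ √n * √n := by gcongr; linarith
          _ = n := Real.mul_self_sqrt hn'.le
      linarith
    push_cast
    change 2 * (K : ℝ) + 4 * k + 2 * d ≤ u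
    linarith
  have hPsmall : ∀ i ≤ L, ‖(α + β * (x₀ + i : ℕ)) * (P.map (Int.castRingHom ℂ)).eval z +
      β * z * (Polynomial.derivative (P.map (Int.castRingHom ℂ))).eval z‖ +
        (d + 1) * H * ε < 1 := fun i hi => by
    have h1 : (d + 1) * H * ε ≤ 1 / 1000 := by
      calc (d + 1) * H * ε ≤ (d + 1) * Y ^ 4 * ε := by gcongr
        _ = (d + 1) / Y := by rw [hε]; field_simp
        _ ≤ 1 / 1000 := by
          rw [div_le_div_iff₀ hY0 (by norm_num)]
          have h2 : (d : ℝ) + 1 ≤ (d + 1) ^ 8 :=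
            le_self_pow₀ (by linarith [Nat.cast_nonneg (α := ℝ) d]) (by norm_num)
          linarith
    have h2 : ‖(α + β * (x₀ + i : ℕ)) * (P.map (Int.castRingHom ℂ)).eval z +
        β * z * (Polynomial.derivative (P.map (Int.castRingHom ℂ))).eval z‖ ≤ 4 * ρ := by
      refine (norm_add_le _ _).trans ?_
      rw [norm_mul, norm_mul, norm_mul, hz, mul_one]
      calc _ ≤ ρ * n * (2 / n) + ρ * (2 / n) := by
            gcongr
            exact hαρ i hi
        _ = 2 * ρ + 2 * ρ * (1 / n) := by field_simp
        _ ≤ 2 * ρ + 2 * ρ * 1 := by gcongr; exact (div_le_one hn').2 hn1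
        _ = 4 * ρ := by ring
    linarith
  have hksmall : ∀ i ≤ L, ‖(α + β * (x₀ + i : ℕ)) * (z ^ k - 1) ^ 2 +
      2 * β * k * z ^ k * (z ^ k - 1)‖ + 4 * ε < 1 := fun i hi => by
    have h2 : ‖(α + β * (x₀ + i : ℕ)) * (z ^ k - 1) ^ 2 +
        2 * β * k * z ^ k * (z ^ k - 1)‖ ≤ 60 * ρ := by
      refine (norm_add_le _ _).trans ?_
      simp only [norm_mul, norm_pow, hz, one_pow, mul_one, Complex.norm_ofNat,
        Complex.norm_natCast]
      calc _ ≤ ρ * n * (2 * π / √n) ^ 2 + 2 * ρ * √n * (2 * π / √n) := by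
            gcongr
            exact hαρ i hi
        _ = ρ * (4 * π ^ 2 + 4 * π) := by
            rw [div_pow, hsq]; field_simp; ring
        _ ≤ ρ * 60 := by
            gcongr
            nlinarith [Real.pi_lt_d2, Real.pi_pos]
        _ = 60 * ρ := mul_comm _ _
    linarith
  have hmain := norm_pow_sub_one_sq_le hz (w := w) (fun i => ⟨_, rfl⟩) herr hP0 hPd hPH hPsmall
    hksmall hk0 hK0 ((hdN.mul_left 2).mul_right M) hL
  have hx₀n : (1 : ℝ) / 2 ≤ x₀ / n := by
    rw [div_le_div_iff₀ two_pos hn']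
    exact_mod_cast (by omega : 1 * n ≤ x₀ * 2)
  have hD₁₂ : D.1 ^ 2 / 4 + D.2 ^ 2 / 4 ≤ ‖α + β * x₀‖ ^ 2 := by
    have h1 : (1 / 2 : ℝ) ^ 2 ≤ (x₀ / n) ^ 2 := by gcongr
    have h2 := mul_le_mul_of_nonneg_left h1 (sq_nonneg D.2)
    rw [hnorm, mul_pow]
    linarith [sq_nonneg D.1]
  have hA : 1 / 4 ≤ ‖α + β * x₀‖ := by
    refine (sq_le_sq₀ (by norm_num) (norm_nonneg _)).1 (le_trans ?_ hD₁₂)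
    linarith
  have hβK : ‖β‖ * K ≤ ‖α + β * x₀‖ / 8 := by
    have h1 : |D.2| / 2 ≤ ‖α + β * x₀‖ := by
      refine (sq_le_sq₀ (by positivity) (norm_nonneg _)).1 (le_trans ?_ hD₁₂)
      rw [div_pow, sq_abs]
      linarith [sq_nonneg D.1]
    have h2 : u ≤ n := div_le_self hn'.le (by linarith)
    have h3 : ‖β‖ * K ≤ ‖β‖ * (n / 100) := by gcongr; linarith
    have h4 : ‖β‖ * (n / 100) = |D.2| / 100 := by rw [hβn]; field_simp
    linarith [norm_nonneg (α + β * x₀)]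
  have := le_norm_mul_pow_sub_one_sq_add hz hMz hβK
  linarith

theorem stmt12 (τ c₁ c₂ : ℝ) (hτ : 0 < τ) (hτ' : τ ≤ 1 / 64)
    (hc₁ : 0 < c₁) (hc₂ : 0 < c₂) :
    ∃ C₀'₀ : ℝ, ∀ C₀' ≥ C₀'₀, ∃ n₀ : ℕ, ∀ n : ℕ, n₀ ≤ n →
      ∀ t ∈ Set.Icc (-Real.pi) Real.pi, Condition n τ C₀' t →
      ∀ D : ℝ × ℝ,
        c₁ * (n : ℝ) ^ (5 * τ - 1 / 2) ≤ Real.sqrt (D.1 ^ 2 + D.2 ^ 2) →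
        Real.sqrt (D.1 ^ 2 + D.2 ^ 2) ≤ c₂ * (n : ℝ) ^ (1 - 8 * τ) →
        (n : ℝ) ^ τ ≤ ∑ i ∈ Finset.Icc 1 n,
          ((distZ (ipv n t i D)) ^ 2 + (distZ (ipv' n t i D)) ^ 2) := by
  set d := ⌈5 / τ⌉₊ with hd
  set N := (d + 1).factorial ^ (d + 1) with hN
  have hN0 : 0 < N := by positivity
  refine ⟨N, fun C₀' hC => ?_⟩
  have htend : Filter.Tendsto (fun n : ℕ => (n : ℝ) ^ (τ / 4)) Filter.atTop Filter.atTop :=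
    (tendsto_rpow_atTop (by positivity)).comp tendsto_natCast_atTop_atTop
  obtain ⟨n₀, hn₀⟩ := Filter.eventually_atTop.1 <|
    (((htend.eventually_ge_atTop 1000).and
      (htend.eventually_ge_atTop (1000 * (d + 1 : ℝ) ^ 8))).and
      ((htend.eventually_ge_atTop (100 * (N : ℝ))).and
      (htend.eventually_ge_atTop (100 * c₂)))).and
      (htend.eventually_ge_atTop (8 / c₁ ^ 2))
  refine ⟨max n₀ 1, fun n hn t _ hcond D hD₁ hD₂ => ?_⟩
  obtain ⟨⟨⟨hY, hYd⟩, hYN, hYc₂⟩, hYc₁⟩ := hn₀ n ((le_max_left _ _).trans hn)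
  have hn1 : (1 : ℝ) ≤ n := by exact_mod_cast (le_max_right _ _).trans hn
  have hn' : (0 : ℝ) < n := by linarith
  set Y := (n : ℝ) ^ (τ / 4) with hYdef
  have hpow : ∀ j : ℕ, Y ^ j = (n : ℝ) ^ (τ / 4 * j) := fun j => by
    rw [hYdef, ← Real.rpow_natCast, ← Real.rpow_mul hn'.le]
  have h4 : (n : ℝ) ^ τ = Y ^ 4 := by rw [hpow]; congr 1; push_cast; ring
  have hupper : c₂ * (n : ℝ) ^ (1 - 8 * τ) = c₂ * n / Y ^ 32 := by
    rw [Real.rpow_sub hn', Real.rpow_one, hpow, mul_div_assoc]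
    congr 3; push_cast; ring
  have hlower : (c₁ * (n : ℝ) ^ (5 * τ - 1 / 2)) ^ 2 = c₁ ^ 2 * Y ^ 40 / n := by
    rw [mul_pow, ← Real.rpow_natCast ((n : ℝ) ^ _), ← Real.rpow_mul hn'.le, hpow, mul_div_assoc,
      ← Real.rpow_sub_one hn'.ne']
    congr 2; push_cast; ring
  have hD0 : 0 ≤ D.1 ^ 2 + D.2 ^ 2 := by positivity
  rw [h4]
  refine pow_four_le_sum_distZ_sq (c₁ := c₁) hN0 dvd_rfl hc₂ hY hYd hYN hYc₂ ?_ ?_ ?_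
    (fun m => ?_) ?_ ?_
  · rw [mul_comm]
    exact (div_le_iff₀ (by positivity)).1 hYc₁
  · rw [hpow]
    refine (Real.rpow_le_rpow_of_exponent_le hn1 ?_).trans_eq (Real.rpow_one _)
    push_cast; linarith
  · rw [hpow, ← Real.rpow_natCast]
    refine Real.rpow_le_rpow_of_exponent_le hn1 ?_
    have : 5 ≤ d * τ := (div_le_iff₀ hτ).1 (Nat.le_ceil _)
    push_cast; linarith
  · have h := hcond N (by exact_mod_cast hN0.ne') (by simpa using hC) m
    have h32 : (n : ℝ) ^ (-1 + 8 * τ) = Y ^ 32 / n := by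
      rw [hpow, ← Real.rpow_sub_one hn'.ne']
      congr 1; push_cast; ring
    rw [h32] at h
    exact_mod_cast h
  · rw [← hlower]
    exact (Real.le_sqrt (by positivity) hD0).1 hD₁
  · rw [← hupper]
    exact (Real.sqrt_le_left (by positivity)).1 hD₂
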